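/- Let n ≥ 2, m ≥ 2, and let B_1, ..., B_m be n×n real symmetric matrices, not all zero, such that Σ_{r,s=1}^m ‖[B_r, B_s]‖² = (Σ_{r=1}^m ‖B_r‖²)². Then there exist an orthogonal m×m matrix R = (R_{rs}), an orthogonal n×n matrix P, a nonzero real number μ, and two distinct indices r₁, r₂ ∈ {1,...,m} such that the rotated family C_r := Σ_{s=1}^m R_{sr} B_s satisfies: C_r = 0 for all r ∉ {r₁, r₂}, C_{r₁} = P H₁ Pᵗ and C_{r₂} = P H₂ Pᵗ, where H₁ is the n×n matrix with (1,2) and (2,1) entries equal to μ and all other entries 0, and H₂ is the n×n diagonal matrix with (1,1) entry μ, (2,2) entry −μ, and all other entries 0. -/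

import Mathlib

open Matrix BigOperators

/-- The squared Frobenius norm: sum of squares of the entries. -/
noncomputable def frobSq {n : ℕ} (A : Matrix (Fin n) (Fin n) ℝ) : ℝ :=
  ∑ i, ∑ j, (A i j) ^ 2

/-- The commutator of two matrices. -/
def mcomm {n : ℕ} (A B : Matrix (Fin n) (Fin n) ℝ) : Matrix (Fin n) (Fin n) ℝ :=
  A * B - B * A

/-- The n×n matrix with (1,2) and (2,1) entries equal to μ and all other entries 0
(using 0-based indices 0 and 1). -/
def H1 (n : ℕ) (μ : ℝ) : Matrix (Fin n) (Fin n) ℝ :=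
  Matrix.of fun i j => if (i.1 = 0 ∧ j.1 = 1) ∨ (i.1 = 1 ∧ j.1 = 0) then μ else 0

/-- The n×n diagonal matrix with (1,1) entry μ, (2,2) entry −μ and all other entries 0
(using 0-based indices 0 and 1). -/
def H2 (n : ℕ) (μ : ℝ) : Matrix (Fin n) (Fin n) ℝ :=
  Matrix.of fun i j =>
    if i.1 = 0 ∧ j.1 = 0 then μ else if i.1 = 1 ∧ j.1 = 1 then -μ else 0


/-- Pairs with large differences form a star. -/
lemma star_lemma {n : ℕ} (η : Fin n → ℝ) (a : ℝ) (ha : a = ∑ i, η i ^ 2) (hpos : 0 < a) :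
    (∀ i j, (η i - η j) ^ 2 ≤ a) ∨
      ∃ c, ∀ i j, a < (η i - η j) ^ 2 → i = c ∨ j = c := by
  have hne : ∀ i j, a < (η i - η j) ^ 2 → i ≠ j := by
    rintro i j h rfl
    simp at h; linarith
  have hsub : ∀ s : Finset (Fin n), ∑ i ∈ s, η i ^ 2 ≤ a := fun s => by
    rw [ha]
    exact Finset.sum_le_sum_of_subset_of_nonneg (Finset.subset_univ s) (fun _ _ _ => sq_nonneg _)
  have hdisj : ∀ i j k l, a < (η i - η j) ^ 2 → a < (η k - η l) ^ 2 →
      i = k ∨ i = l ∨ j = k ∨ j = l := by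
    intro i j k l h1 h2
    by_contra hcon
    push Not at hcon
    obtain ⟨h3, h4, h5, h6⟩ := hcon
    have h := hsub {i, j, k, l}
    rw [Finset.sum_insert (by simp [hne i j h1, h3, h4]), Finset.sum_insert (by simp [h5, h6]),
      Finset.sum_insert (by simp [hne k l h2]), Finset.sum_singleton] at h
    nlinarith [sq_nonneg (η i + η j), sq_nonneg (η k + η l)]
  have htri : ∀ i j k, a < (η i - η j) ^ 2 → a < (η j - η k) ^ 2 → a < (η i - η k) ^ 2 → False := by
    intro i j k h1 h2 h3
    have h := hsub {i, j, k}
    rw [Finset.sum_insert (by simp [hne i j h1, hne i k h3]), Finset.sum_insert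
      (by simp [hne j k h2]), Finset.sum_singleton] at h
    nlinarith [sq_nonneg (η i + η j + η k)]
  have hsy : ∀ i j, a < (η i - η j) ^ 2 → a < (η j - η i) ^ 2 := by
    intro i j h
    have : (η j - η i) ^ 2 = (η i - η j) ^ 2 := by ring
    rwa [this]
  by_contra hcon
  push Not at hcon
  obtain ⟨⟨i, j, hij⟩, hall⟩ := hcon
  obtain ⟨k, l, hkl, hki, hli⟩ := hall i
  obtain ⟨k', l', hkl', hki', hli'⟩ := hall j
  -- an edge from j avoiding i
  have e2 : ∃ p, p ≠ i ∧ a < (η j - η p) ^ 2 := by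
    rcases hdisj i j k l hij hkl with h | h | h | h
    · exact absurd h.symm hki
    · exact absurd h.symm hli
    · exact ⟨l, hli, h ▸ hkl⟩
    · exact ⟨k, hki, h ▸ hsy _ _ hkl⟩
  have e3 : ∃ p, p ≠ j ∧ a < (η i - η p) ^ 2 := by
    rcases hdisj i j k' l' hij hkl' with h | h | h | h
    · exact ⟨l', hli', h ▸ hkl'⟩
    · exact ⟨k', hki', h ▸ hsy _ _ hkl'⟩
    · exact absurd h.symm hki'
    · exact absurd h.symm hli'
  obtain ⟨p, hp, hp'⟩ := e2
  obtain ⟨q, hq, hq'⟩ := e3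
  rcases hdisj j p i q hp' hq' with h | h | h | h
  · exact hne i j hij h.symm
  · exact hq h.symm
  · exact hp h
  · subst h
    exact htri i j p hij hp' hq'

lemma pos_sum_bound {n : ℕ} (η : Fin n → ℝ) (a : ℝ) (ha : a = ∑ i, η i ^ 2) (hpos : 0 < a) :
    ∑ i, ∑ j, max ((η i - η j) ^ 2 - a) 0 ≤ 2 * a := by
  rcases star_lemma η a ha hpos with h | ⟨c, hc⟩
  · have : ∑ i, ∑ j, max ((η i - η j) ^ 2 - a) 0 = 0 := by
      apply Finset.sum_eq_zero; intro i _
      apply Finset.sum_eq_zero; intro j _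
      exact max_eq_right (by linarith [h i j])
    linarith
  · -- the centre's row
    have hrow : ∑ j, max ((η c - η j) ^ 2 - a) 0 ≤ a := by
      set L := Finset.univ.filter (fun j => a < (η c - η j) ^ 2) with hL
      have h1 : ∑ j, max ((η c - η j) ^ 2 - a) 0 = ∑ j ∈ L, ((η c - η j) ^ 2 - a) := by
        rw [hL, Finset.sum_filter]
        apply Finset.sum_congr rfl; intro j _
        split_ifs with hj
        · exact max_eq_left (by linarith)
        · exact max_eq_right (by linarith)
      have hcL : c ∉ L := by
        simp [hL]; linarith
      have h2 : η c ^ 2 + ∑ j ∈ L, η j ^ 2 ≤ a := by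
        rw [← Finset.sum_insert (f := fun j => η j ^ 2) hcL, ha]
        exact Finset.sum_le_sum_of_subset_of_nonneg (Finset.subset_univ _)
          (fun _ _ _ => sq_nonneg _)
      have h3 : (∑ j ∈ L, η j) ^ 2 ≤ L.card * ∑ j ∈ L, η j ^ 2 := sq_sum_le_card_mul_sum_sq
      have h4 : ∑ j ∈ L, ((η c - η j) ^ 2 - a) =
          L.card * η c ^ 2 - 2 * η c * ∑ j ∈ L, η j + ∑ j ∈ L, η j ^ 2 - L.card * a := by
        simp only [sub_sq, Finset.sum_sub_distrib, Finset.sum_add_distrib, Finset.mul_sum,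
          Finset.sum_const, nsmul_eq_mul]
      rw [h1, h4]
      have h5 : (0:ℝ) ≤ L.card := Nat.cast_nonneg _
      nlinarith [sq_nonneg (η c + ∑ j ∈ L, η j), mul_le_mul_of_nonneg_left h2 h5]
    have hpt : ∀ i j, max ((η i - η j) ^ 2 - a) 0 ≤
        (if i = c then max ((η c - η j) ^ 2 - a) 0 else 0) +
        (if j = c then max ((η c - η i) ^ 2 - a) 0 else 0) := by
      intro i j
      by_cases hij : a < (η i - η j) ^ 2
      · rcases hc i j hij with rfl | rfl
        · simp only [if_true]
          have : 0 ≤ (if j = i then max ((η i - η i) ^ 2 - a) 0 else 0) := by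
            split_ifs <;> simp
          linarith
        · simp only [if_true]
          have : 0 ≤ (if i = j then max ((η j - η j) ^ 2 - a) 0 else 0) := by
            split_ifs <;> simp
          have h6 : (η j - η i) ^ 2 = (η i - η j) ^ 2 := by ring
          rw [h6]
          linarith
      · rw [max_eq_right (by linarith)]
        apply add_nonneg <;> split_ifs <;> simp
    calc ∑ i, ∑ j, max ((η i - η j) ^ 2 - a) 0
        ≤ ∑ i, ∑ j, ((if i = c then max ((η c - η j) ^ 2 - a) 0 else 0) +
        (if j = c then max ((η c - η i) ^ 2 - a) 0 else 0)) :=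
          Finset.sum_le_sum fun i _ => Finset.sum_le_sum fun j _ => hpt i j
      _ = ∑ j, max ((η c - η j) ^ 2 - a) 0 + ∑ i, max ((η c - η i) ^ 2 - a) 0 := by
          simp only [Finset.sum_add_distrib]
          congr 1
          · rw [Finset.sum_comm]; simp
          · simp
      _ ≤ 2 * a := by linarith

/-- Linear combination of a family. -/
noncomputable def comb {n m : ℕ} (u : Fin m → ℝ) (B : Fin m → Matrix (Fin n) (Fin n) ℝ) :
    Matrix (Fin n) (Fin n) ℝ := ∑ r, u r • B r

lemma comb_apply {n m : ℕ} (u : Fin m → ℝ) (B : Fin m → Matrix (Fin n) (Fin n) ℝ) (i j : Fin n) :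
    comb u B i j = ∑ r, u r * B r i j := by
  simp [comb, Matrix.sum_apply]

lemma frobSq_nonneg {n : ℕ} (A : Matrix (Fin n) (Fin n) ℝ) : 0 ≤ frobSq A :=
  Finset.sum_nonneg fun _ _ => Finset.sum_nonneg fun _ _ => sq_nonneg _

lemma frobSq_eq_trace {n : ℕ} (A : Matrix (Fin n) (Fin n) ℝ) : frobSq A = (A * Aᵀ).trace := by
  simp [frobSq, Matrix.trace, Matrix.mul_apply, sq]

lemma frobSq_smul {n : ℕ} (c : ℝ) (A : Matrix (Fin n) (Fin n) ℝ) :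
    frobSq (c • A) = c ^ 2 * frobSq A := by
  simp [frobSq, Finset.mul_sum, mul_pow]

lemma mcomm_smul_smul {n : ℕ} (c d : ℝ) (A B : Matrix (Fin n) (Fin n) ℝ) :
    mcomm (c • A) (d • B) = (c * d) • mcomm A B := by
  simp [mcomm, smul_sub, smul_smul, mul_comm]

lemma frobSq_conj {n : ℕ} (Q A : Matrix (Fin n) (Fin n) ℝ) (hQ : Q * Qᵀ = 1) :
    frobSq (Qᵀ * A * Q) = frobSq A := by
  rw [frobSq_eq_trace, frobSq_eq_trace]
  simp only [Matrix.transpose_mul, Matrix.transpose_transpose]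
  have : Qᵀ * A * Q * (Qᵀ * (Aᵀ * Q)) = Qᵀ * (A * (Q * Qᵀ) * Aᵀ * Q) := by
    simp only [Matrix.mul_assoc]
  rw [this, hQ, Matrix.trace_mul_comm]
  simp only [Matrix.mul_assoc, hQ, Matrix.mul_one]

lemma mcomm_conj {n : ℕ} (Q A B : Matrix (Fin n) (Fin n) ℝ) (hQ : Q * Qᵀ = 1) :
    mcomm (Qᵀ * A * Q) (Qᵀ * B * Q) = Qᵀ * mcomm A B * Q := by
  have key : ∀ A B : Matrix (Fin n) (Fin n) ℝ,
      Qᵀ * A * Q * (Qᵀ * B * Q) = Qᵀ * (A * B) * Q := by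
    intro A B
    have : Qᵀ * A * Q * (Qᵀ * B * Q) = Qᵀ * A * (Q * Qᵀ) * B * Q := by
      simp only [Matrix.mul_assoc]
    rw [this, hQ]; simp only [Matrix.mul_assoc, Matrix.mul_one, Matrix.one_mul]
  simp only [mcomm, key, Matrix.mul_sub, Matrix.sub_mul]

lemma comb_conj {n m : ℕ} (Q : Matrix (Fin n) (Fin n) ℝ) (u : Fin m → ℝ)
    (B : Fin m → Matrix (Fin n) (Fin n) ℝ) :
    comb u (fun r => Qᵀ * B r * Q) = Qᵀ * comb u B * Q := by
  simp [comb, Finset.mul_sum, Finset.sum_mul]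

lemma comb_symm {n m : ℕ} (u : Fin m → ℝ) (B : Fin m → Matrix (Fin n) (Fin n) ℝ)
    (h : ∀ r, (B r).IsSymm) : (comb u B).IsSymm := by
  ext i j
  rw [Matrix.transpose_apply, comb_apply, comb_apply]
  exact Finset.sum_congr rfl fun r _ => by rw [(h r).apply]

/-- total squared length of the (i,j)-entries -/
noncomputable def qq {n m : ℕ} (B : Fin m → Matrix (Fin n) (Fin n) ℝ) (i j : Fin n) : ℝ :=
  ∑ r, (B r i j) ^ 2

lemma qq_nonneg {n m : ℕ} (B : Fin m → Matrix (Fin n) (Fin n) ℝ) (i j : Fin n) : 0 ≤ qq B i j :=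
  Finset.sum_nonneg fun _ _ => sq_nonneg _

lemma sum_frobSq_eq {n m : ℕ} (B : Fin m → Matrix (Fin n) (Fin n) ℝ) :
    ∑ r, frobSq (B r) = ∑ i, ∑ j, qq B i j := by
  simp only [frobSq, qq]
  rw [Finset.sum_comm]
  refine Finset.sum_congr rfl fun i _ => ?_
  rw [Finset.sum_comm]

lemma frobSq_diagonal {n : ℕ} (η : Fin n → ℝ) : frobSq (Matrix.diagonal η) = ∑ i, η i ^ 2 := by
  simp [frobSq, Matrix.diagonal_apply, ite_pow]

lemma sum_comm_diagonal {n m : ℕ} (B : Fin m → Matrix (Fin n) (Fin n) ℝ) (η : Fin n → ℝ) :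
    ∑ r, frobSq (mcomm (Matrix.diagonal η) (B r)) = ∑ i, ∑ j, (η i - η j) ^ 2 * qq B i j := by
  have h : ∀ r i j, (mcomm (Matrix.diagonal η) (B r) i j) ^ 2 = (η i - η j) ^ 2 * (B r i j) ^ 2 := by
    intro r i j
    simp [mcomm, Matrix.diagonal_mul, Matrix.mul_diagonal]
    ring
  simp only [frobSq, qq, h, Finset.mul_sum]
  rw [Finset.sum_comm]
  refine Finset.sum_congr rfl fun i _ => ?_
  rw [Finset.sum_comm]

lemma diag_bound {n m : ℕ} (B : Fin m → Matrix (Fin n) (Fin n) ℝ) (η : Fin n → ℝ) (a : ℝ)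
    (ha : a = ∑ i, η i ^ 2) (hpos : 0 < a) (M : ℝ) (hM0 : 0 ≤ M)
    (hM : ∀ i j, i ≠ j → qq B i j ≤ M) :
    ∑ r, frobSq (mcomm (Matrix.diagonal η) (B r)) - a * ∑ r, frobSq (B r) ≤
      2 * a * M - a * ∑ i, qq B i i := by
  rw [sum_comm_diagonal, sum_frobSq_eq]
  have hpt : ∀ i j, ((η i - η j) ^ 2 - a) * qq B i j ≤
      max ((η i - η j) ^ 2 - a) 0 * M - (if i = j then a * qq B i i else 0) := by
    intro i j
    split_ifs with hij
    · subst hij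
      have : max ((η i - η i) ^ 2 - a) 0 = 0 := max_eq_right (by simp; linarith)
      rw [this]; simp
    · have h1 := hM i j hij
      have h2 := qq_nonneg B i j
      have h3 := le_max_left ((η i - η j) ^ 2 - a) 0
      have h4 := le_max_right ((η i - η j) ^ 2 - a) 0
      nlinarith [mul_le_mul_of_nonneg_right h3 h2, mul_le_mul_of_nonneg_left h1 h4]
  have hs := Finset.sum_le_sum fun i (_ : i ∈ Finset.univ) =>
    Finset.sum_le_sum fun j (_ : j ∈ Finset.univ) => hpt i j
  have hb := pos_sum_bound η a ha hpos
  simp only [Finset.sum_sub_distrib, ← Finset.sum_mul, sub_mul, Finset.sum_ite_eq,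
    Finset.mem_univ, if_true, ← Finset.mul_sum] at hs
  nlinarith [mul_le_mul_of_nonneg_right hb hM0]

lemma qq_offdiag_le {n m : ℕ} (B : Fin m → Matrix (Fin n) (Fin n) ℝ) (hs : ∀ r, (B r).IsSymm)
    (a : ℝ) (ha0 : 0 ≤ a) (hmax : ∀ v : Fin m → ℝ, frobSq (comb v B) ≤ (∑ r, v r ^ 2) * a)
    (i j : Fin n) (hij : i ≠ j) : qq B i j ≤ a / 2 := by
  have h1 := hmax (fun r => B r i j)
  have h2 : comb (fun r => B r i j) B i j = qq B i j := by
    rw [comb_apply, qq]; exact Finset.sum_congr rfl fun r _ => by ring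
  have h3 : comb (fun r => B r i j) B j i = qq B i j := by
    rw [(comb_symm _ B hs).apply, h2]
  have h4 : 2 * qq B i j ^ 2 ≤ frobSq (comb (fun r => B r i j) B) := by
    set C := comb (fun r => B r i j) B
    have e1 : ∀ k l : Fin n, C k l ^ 2 ≤ ∑ l, C k l ^ 2 := fun k l =>
      Finset.single_le_sum (f := fun l => C k l ^ 2) (fun _ _ => sq_nonneg _) (Finset.mem_univ l)
    have e2 : ∑ k ∈ {i, j}, ∑ l, C k l ^ 2 ≤ frobSq C :=
      Finset.sum_le_sum_of_subset_of_nonneg (Finset.subset_univ _)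
        (fun _ _ _ => Finset.sum_nonneg fun _ _ => sq_nonneg _)
    rw [Finset.sum_pair hij] at e2
    have e3 := e1 i j
    have e4 := e1 j i
    rw [h2] at e3
    rw [h3] at e4
    linarith
  change frobSq (comb (fun r => B r i j) B) ≤ qq B i j * a at h1
  rcases (qq_nonneg B i j).eq_or_lt with h0 | h0
  · rw [← h0]
    linarith
  · have : 2 * qq B i j ≤ a := by
      by_contra hc
      push Not at hc
      nlinarith
    linarith

noncomputable def SS {n m : ℕ} (B : Fin m → Matrix (Fin n) (Fin n) ℝ) : ℝ := ∑ r, frobSq (B r)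

noncomputable def FF {n m : ℕ} (B : Fin m → Matrix (Fin n) (Fin n) ℝ) : ℝ :=
  ∑ r, ∑ s, frobSq (mcomm (B r) (B s))

noncomputable def TT {n m : ℕ} (A : Matrix (Fin n) (Fin n) ℝ)
    (B : Fin m → Matrix (Fin n) (Fin n) ℝ) : ℝ := ∑ s, frobSq (mcomm A (B s))

lemma scalar_S {m : ℕ} (u b : Fin m → ℝ) (t α : ℝ) (hα : ∑ r, u r * b r = α) :
    ∑ r, (b r + t * (u r * α)) ^ 2 = ∑ r, b r ^ 2 + (2 * t + t ^ 2 * ∑ r, u r ^ 2) * α ^ 2 := by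
  have h : ∀ r, (b r + t * (u r * α)) ^ 2 =
      b r ^ 2 + (2 * t * α) * (u r * b r) + (t ^ 2 * α ^ 2) * u r ^ 2 := fun r => by ring
  simp only [h, Finset.sum_add_distrib, ← Finset.mul_sum, hα]
  ring

lemma scalar_F {m : ℕ} (u d : Fin m → ℝ) (c : Fin m → Fin m → ℝ) (t : ℝ)
    (hanti : ∀ r s, c r s = - c s r) (hd : ∀ s, ∑ r, u r * c r s = d s) (h0 : ∑ s, u s * d s = 0) :
    ∑ r, ∑ s, (c r s + t * (u r * d s - u s * d r)) ^ 2 =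
      ∑ r, ∑ s, c r s ^ 2 + 2 * (2 * t + t ^ 2 * ∑ r, u r ^ 2) * ∑ s, d s ^ 2 := by
  have h : ∀ r s, (c r s + t * (u r * d s - u s * d r)) ^ 2 =
      c r s ^ 2 + (2 * t) * (d s * (u r * c r s)) + (2 * t) * (d r * (u s * c s r))
      + t ^ 2 * (u r ^ 2 * d s ^ 2) + t ^ 2 * (d r ^ 2 * u s ^ 2)
      - (2 * t ^ 2) * ((u r * d r) * (u s * d s)) := fun r s => by
    rw [hanti s r]; ring
  have e1 : ∑ r, ∑ s, d s * (u r * c r s) = ∑ s, d s ^ 2 := by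
    rw [Finset.sum_comm]
    refine Finset.sum_congr rfl fun s _ => ?_
    rw [← Finset.mul_sum, hd, sq]
  simp only [h, Finset.sum_add_distrib, Finset.sum_sub_distrib, ← Finset.mul_sum, e1, hd]
  simp only [← Finset.sum_mul, h0, ← sq]
  ring

lemma SS_pert {n m : ℕ} (B : Fin m → Matrix (Fin n) (Fin n) ℝ) (u : Fin m → ℝ) (t : ℝ) :
    SS (fun r => B r + (t * u r) • comb u B) =
      SS B + (2 * t + t ^ 2 * ∑ r, u r ^ 2) * frobSq (comb u B) := by
  unfold SS
  rw [sum_frobSq_eq, sum_frobSq_eq]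
  have h : ∀ i j, qq (fun r => B r + (t * u r) • comb u B) i j =
      qq B i j + (2 * t + t ^ 2 * ∑ r, u r ^ 2) * (comb u B i j) ^ 2 := by
    intro i j
    unfold qq
    rw [← scalar_S u (fun r => B r i j) t _ (comb_apply u B i j).symm]
    refine Finset.sum_congr rfl fun r _ => ?_
    simp [mul_assoc]
  simp only [h, Finset.sum_add_distrib, ← Finset.mul_sum, frobSq]

lemma mcomm_comb {n m : ℕ} (B : Fin m → Matrix (Fin n) (Fin n) ℝ) (u : Fin m → ℝ)
    (X : Matrix (Fin n) (Fin n) ℝ) : mcomm (comb u B) X = ∑ r, u r • mcomm (B r) X := by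
  simp [mcomm, comb, Finset.sum_mul, Finset.mul_sum, smul_sub]

lemma mcomm_comb' {n m : ℕ} (B : Fin m → Matrix (Fin n) (Fin n) ℝ) (u : Fin m → ℝ)
    (X : Matrix (Fin n) (Fin n) ℝ) : mcomm X (comb u B) = ∑ r, u r • mcomm X (B r) := by
  simp [mcomm, comb, Finset.sum_mul, Finset.mul_sum, smul_sub]

lemma FF_eq {n m : ℕ} (B : Fin m → Matrix (Fin n) (Fin n) ℝ) :
    FF B = ∑ i, ∑ j, ∑ r, ∑ s, (mcomm (B r) (B s) i j) ^ 2 := by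
  simp only [FF, frobSq]
  have : ∀ r, ∑ s, ∑ i, ∑ j, (mcomm (B r) (B s) i j) ^ 2 =
      ∑ i, ∑ j, ∑ s, (mcomm (B r) (B s) i j) ^ 2 := by
    intro r
    rw [Finset.sum_comm]
    refine Finset.sum_congr rfl fun i _ => ?_
    rw [Finset.sum_comm]
  simp only [this]
  rw [Finset.sum_comm]
  refine Finset.sum_congr rfl fun i _ => ?_
  rw [Finset.sum_comm]

lemma TT_eq {n m : ℕ} (A : Matrix (Fin n) (Fin n) ℝ) (B : Fin m → Matrix (Fin n) (Fin n) ℝ) :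
    TT A B = ∑ i, ∑ j, ∑ s, (mcomm A (B s) i j) ^ 2 := by
  simp only [TT, frobSq]
  rw [Finset.sum_comm]
  refine Finset.sum_congr rfl fun i _ => ?_
  rw [Finset.sum_comm]

lemma FF_pert {n m : ℕ} (B : Fin m → Matrix (Fin n) (Fin n) ℝ) (u : Fin m → ℝ) (t : ℝ) :
    FF (fun r => B r + (t * u r) • comb u B) =
      FF B + 2 * (2 * t + t ^ 2 * ∑ r, u r ^ 2) * TT (comb u B) B := by
  rw [FF_eq, FF_eq, TT_eq]
  have h : ∀ i j, ∑ r, ∑ s, (mcomm (B r + (t * u r) • comb u B)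
        (B s + (t * u s) • comb u B) i j) ^ 2 =
      ∑ r, ∑ s, (mcomm (B r) (B s) i j) ^ 2 +
        2 * (2 * t + t ^ 2 * ∑ r, u r ^ 2) * ∑ s, (mcomm (comb u B) (B s) i j) ^ 2 := by
    intro i j
    rw [← scalar_F u (fun s => mcomm (comb u B) (B s) i j) (fun r s => mcomm (B r) (B s) i j) t]
    · refine Finset.sum_congr rfl fun r _ => Finset.sum_congr rfl fun s _ => ?_
      congr 1
      have : mcomm (B r + (t * u r) • comb u B) (B s + (t * u s) • comb u B) =
          mcomm (B r) (B s) + t • (u r • mcomm (comb u B) (B s) - u s • mcomm (comb u B) (B r)) := by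
        unfold mcomm
        simp only [Matrix.add_mul, Matrix.mul_add, Matrix.smul_mul, Matrix.mul_smul, smul_sub,
          smul_add, smul_smul]
        rw [show t * u s * (t * u r) = t * u r * (t * u s) by ring]
        abel
      rw [this]
      simp
    · intro r s; simp [mcomm]
    · intro s
      rw [mcomm_comb]; simp [Matrix.sum_apply]
    · have : mcomm (comb u B) (comb u B) = 0 := by simp [mcomm]
      rw [mcomm_comb'] at this
      have := congrFun (congrFun this i) j
      simpa [Matrix.sum_apply] using this
  simp only [h, Finset.sum_add_distrib, ← Finset.mul_sum]

lemma first_order {n m : ℕ} (B : Fin m → Matrix (Fin n) (Fin n) ℝ) (hs : ∀ r, (B r).IsSymm)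
    (κ : ℝ) (hκ : ∀ X : Fin m → Matrix (Fin n) (Fin n) ℝ, (∀ r, (X r).IsSymm) →
      FF X ≤ κ * SS X ^ 2) (hB : FF B = κ * SS B ^ 2) (u : Fin m → ℝ) :
    κ * SS B * frobSq (comb u B) ≤ TT (comb u B) B := by
  set a := frobSq (comb u B)
  set T := TT (comb u B) B
  set c := ∑ r, u r ^ 2
  have hc : 0 ≤ c := Finset.sum_nonneg fun _ _ => sq_nonneg _
  have key : ∀ t : ℝ, 2 * (2 * t + t ^ 2 * c) * T ≤
      κ * (2 * SS B * a * (2 * t + t ^ 2 * c) + a ^ 2 * (2 * t + t ^ 2 * c) ^ 2) := by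
    intro t
    have h := hκ (fun r => B r + (t * u r) • comb u B) (fun r => by
      have h1 := comb_symm u B hs
      exact (hs r).add (h1.smul _))
    rw [FF_pert, SS_pert, hB] at h
    linarith
  by_contra hcon
  push Not at hcon
  set δ := κ * SS B * a - T with hδ
  have hδ0 : 0 < δ := by linarith
  have hK : (0:ℝ) ≤ |κ * a ^ 2| := abs_nonneg _
  set K := |κ * a ^ 2| with hKdef
  obtain ⟨ε, he0, he1, he2⟩ : ∃ ε : ℝ, 0 < ε ∧ ε * c < 1 ∧ ε * K < δ := by
    refine ⟨min (1 / (c + 1)) (δ / (K + 1)), by positivity, ?_, ?_⟩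
    · calc _ ≤ 1 / (c + 1) * c := by gcongr; exact min_le_left _ _
        _ < 1 := by rw [div_mul_eq_mul_div, div_lt_one (by positivity)]; linarith
    · calc _ ≤ δ / (K + 1) * K := by gcongr; exact min_le_right _ _
        _ < δ := by rw [div_mul_eq_mul_div, div_lt_iff₀ (by positivity)]; nlinarith
  have hk := key (-ε)
  set w := ε * (2 - ε * c) with hw
  have hw0 : 0 < w := mul_pos he0 (by linarith)
  have hw2 : w ≤ 2 * ε := by nlinarith [mul_nonneg he0.le hc]
  have hww : 2 * -ε + (-ε) ^ 2 * c = -w := by rw [hw]; ring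
  rw [hww] at hk
  have h2 : 2 * δ * w ≤ (κ * a ^ 2) * w * w := by nlinarith
  have h3 : 2 * δ ≤ (κ * a ^ 2) * w := le_of_mul_le_mul_right h2 hw0
  have h4 : (κ * a ^ 2) * w ≤ K * w := mul_le_mul_of_nonneg_right (le_abs_self _) hw0.le
  have h5 : K * w ≤ K * (2 * ε) := mul_le_mul_of_nonneg_left hw2 hK
  linarith

lemma frobSq_eq_zero {n : ℕ} {A : Matrix (Fin n) (Fin n) ℝ} (h : frobSq A = 0) : A = 0 := by
  ext i j
  have h1 := (Finset.sum_eq_zero_iff_of_nonneg (fun i _ => Finset.sum_nonneg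
    fun j _ => sq_nonneg (A i j))).1 h i (Finset.mem_univ i)
  have h2 := (Finset.sum_eq_zero_iff_of_nonneg (fun j _ => sq_nonneg (A i j))).1 h1 j
    (Finset.mem_univ j)
  simpa using h2

lemma comb_smul {n m : ℕ} (c : ℝ) (u : Fin m → ℝ) (B : Fin m → Matrix (Fin n) (Fin n) ℝ) :
    comb (fun r => c * u r) B = c • comb u B := by
  simp [comb, Finset.smul_sum, smul_smul]

lemma continuous_frobSq_comb {n m : ℕ} (B : Fin m → Matrix (Fin n) (Fin n) ℝ) :
    Continuous fun u : Fin m → ℝ => frobSq (comb u B) := by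
  simp only [frobSq, comb_apply]
  fun_prop

lemma sq_le_of_sum {ι : Type*} [Fintype ι] (f : ι → ℝ) (h : ∑ i, f i ^ 2 = 1) (i : ι) :
    |f i| ≤ 1 := by
  have : f i ^ 2 ≤ 1 := by
    rw [← h]
    exact Finset.single_le_sum (f := fun i => f i ^ 2) (fun _ _ => sq_nonneg _) (Finset.mem_univ i)
  exact (sq_le_one_iff_abs_le_one _).1 this

lemma exists_max_dir {n m : ℕ} (B : Fin m → Matrix (Fin n) (Fin n) ℝ) (hne : 0 < SS B) :
    ∃ u : Fin m → ℝ, ∑ r, u r ^ 2 = 1 ∧ 0 < frobSq (comb u B) ∧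
      ∀ v : Fin m → ℝ, frobSq (comb v B) ≤ (∑ r, v r ^ 2) * frobSq (comb u B) := by
  have hcomp : IsCompact {u : Fin m → ℝ | ∑ r, u r ^ 2 = 1} := by
    apply Metric.isCompact_of_isClosed_isBounded
    · exact isClosed_eq (by fun_prop) continuous_const
    · refine (Metric.isBounded_closedBall (x := (0 : Fin m → ℝ)) (r := 1)).subset ?_
      intro u hu
      rw [mem_closedBall_zero_iff, pi_norm_le_iff_of_nonneg zero_le_one]
      intro r
      exact sq_le_of_sum u hu r
  obtain ⟨r0, hr0⟩ : ∃ r, 0 < frobSq (B r) := by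
    by_contra hc
    push Not at hc
    exact absurd hne (not_lt.2 (Finset.sum_nonpos fun r _ => hc r))
  have hsing : ∑ r, (Pi.single r0 1 : Fin m → ℝ) r ^ 2 = 1 := by
    simp [Pi.single_apply, ite_pow]
  obtain ⟨u, hu, hmax⟩ := hcomp.exists_isMaxOn ⟨Pi.single r0 1, hsing⟩
    (continuous_frobSq_comb B).continuousOn
  refine ⟨u, hu, ?_, ?_⟩
  · have h1 := hmax hsing
    have h2 : comb (Pi.single r0 1) B = B r0 := by
      simp [comb, Pi.single_apply]
    simp only [Set.mem_ofPred_eq, h2] at h1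
    linarith
  · intro v
    have hv0 : 0 ≤ ∑ r, v r ^ 2 := Finset.sum_nonneg fun _ _ => sq_nonneg _
    rcases hv0.eq_or_lt with h0 | h0
    · have hz : ∀ r, v r = 0 := by
        intro r
        have := (Finset.sum_eq_zero_iff_of_nonneg (fun _ _ => sq_nonneg _)).1 h0.symm r
          (Finset.mem_univ r)
        simpa using this
      have : comb v B = 0 := by simp [comb, hz]
      rw [← h0, this]
      simp [frobSq]
    · set N := ∑ r, v r ^ 2 with hN
      have hsq : (Real.sqrt N)⁻¹ ^ 2 = N⁻¹ := by rw [inv_pow, Real.sq_sqrt h0.le]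
      have h1 : ∑ r, ((Real.sqrt N)⁻¹ * v r) ^ 2 = 1 := by
        simp only [mul_pow, ← Finset.mul_sum, hsq]
        exact inv_mul_cancel₀ h0.ne'
      have h2 := hmax h1
      simp only [Set.mem_ofPred_eq] at h2
      rw [comb_smul, frobSq_smul, hsq, inv_mul_le_iff₀ h0] at h2
      exact h2

lemma exists_diag {n : ℕ} (A : Matrix (Fin n) (Fin n) ℝ) (hA : A.IsSymm) :
    ∃ (Q : Matrix (Fin n) (Fin n) ℝ) (η : Fin n → ℝ), Q * Qᵀ = 1 ∧ Qᵀ * Q = 1 ∧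
      Qᵀ * A * Q = Matrix.diagonal η := by
  have hH : A.IsHermitian := by
    rw [Matrix.IsHermitian, Matrix.conjTranspose_eq_transpose_of_trivial]; exact hA
  have h1 : (hH.eigenvectorUnitary : Matrix (Fin n) (Fin n) ℝ) *
      (hH.eigenvectorUnitary : Matrix (Fin n) (Fin n) ℝ)ᵀ = 1 := by
    have := Matrix.mem_unitaryGroup_iff.1 hH.eigenvectorUnitary.2
    rwa [Matrix.star_eq_conjTranspose, Matrix.conjTranspose_eq_transpose_of_trivial] at this
  have h2 := mul_eq_one_comm.1 h1
  refine ⟨hH.eigenvectorUnitary, hH.eigenvalues, h1, h2, ?_⟩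
  have h3 := hH.spectral_theorem
  rw [Unitary.conjStarAlgAut_apply] at h3
  have h4 : (star hH.eigenvectorUnitary : Matrix (Fin n) (Fin n) ℝ) =
      (hH.eigenvectorUnitary : Matrix (Fin n) (Fin n) ℝ)ᵀ := by
    rw [Matrix.star_eq_conjTranspose, Matrix.conjTranspose_eq_transpose_of_trivial]
  rw [h4] at h3
  generalize (hH.eigenvectorUnitary : Matrix (Fin n) (Fin n) ℝ) = Q at *
  generalize hH.eigenvalues = η at *
  rw [h3]
  have : Qᵀ * (Q * Matrix.diagonal (RCLike.ofReal ∘ η) * Qᵀ) * Q =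
    (Qᵀ * Q) * Matrix.diagonal (RCLike.ofReal ∘ η) * (Qᵀ * Q) := by simp only [Matrix.mul_assoc]
  rw [this, h2]
  simp

/-- Conjugated family. -/
noncomputable def cj {n m : ℕ} (Q : Matrix (Fin n) (Fin n) ℝ)
    (B : Fin m → Matrix (Fin n) (Fin n) ℝ) : Fin m → Matrix (Fin n) (Fin n) ℝ :=
  fun r => Qᵀ * B r * Q

lemma cj_symm {n m : ℕ} (Q : Matrix (Fin n) (Fin n) ℝ)
    (B : Fin m → Matrix (Fin n) (Fin n) ℝ) (hs : ∀ r, (B r).IsSymm) : ∀ r, (cj Q B r).IsSymm := by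
  intro r
  unfold cj
  rw [Matrix.IsSymm, Matrix.transpose_mul, Matrix.transpose_mul, (hs r).eq,
    Matrix.transpose_transpose, Matrix.mul_assoc]

lemma SS_cj {n m : ℕ} (Q : Matrix (Fin n) (Fin n) ℝ) (hQ : Q * Qᵀ = 1)
    (B : Fin m → Matrix (Fin n) (Fin n) ℝ) : SS (cj Q B) = SS B := by
  simp only [SS, cj, frobSq_conj Q _ hQ]

lemma FF_cj {n m : ℕ} (Q : Matrix (Fin n) (Fin n) ℝ) (hQ : Q * Qᵀ = 1)
    (B : Fin m → Matrix (Fin n) (Fin n) ℝ) : FF (cj Q B) = FF B := by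
  simp only [FF, cj, mcomm_conj Q _ _ hQ, frobSq_conj Q _ hQ]

lemma TT_cj {n m : ℕ} (Q : Matrix (Fin n) (Fin n) ℝ) (hQ : Q * Qᵀ = 1)
    (B : Fin m → Matrix (Fin n) (Fin n) ℝ) (u : Fin m → ℝ) :
    TT (comb u (cj Q B)) (cj Q B) = TT (comb u B) B := by
  have : comb u (cj Q B) = Qᵀ * comb u B * Q := comb_conj Q u B
  rw [this]
  simp only [TT, cj, mcomm_conj Q _ _ hQ, frobSq_conj Q _ hQ]

lemma frobSq_comb_cj {n m : ℕ} (Q : Matrix (Fin n) (Fin n) ℝ) (hQ : Q * Qᵀ = 1)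
    (B : Fin m → Matrix (Fin n) (Fin n) ℝ) (u : Fin m → ℝ) :
    frobSq (comb u (cj Q B)) = frobSq (comb u B) := by
  have : comb u (cj Q B) = Qᵀ * comb u B * Q := comb_conj Q u B
  rw [this, frobSq_conj Q _ hQ]

/-- Cauchy–Schwarz on the diagonal, with the defect made explicit. -/
lemma diag_defect {n m : ℕ} (B : Fin m → Matrix (Fin n) (Fin n) ℝ) (u : Fin m → ℝ)
    (hu : ∑ r, u r ^ 2 = 1) (η : Fin n → ℝ) (hd : comb u B = Matrix.diagonal η) (i : Fin n) :
    ∑ r, (B r i i - η i * u r) ^ 2 = qq B i i - η i ^ 2 := by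
  have h1 : ∑ r, u r * B r i i = η i := by
    rw [← comb_apply, hd]; simp
  have h : ∀ r, (B r i i - η i * u r) ^ 2 =
      (B r i i) ^ 2 - (2 * η i) * (u r * B r i i) + η i ^ 2 * u r ^ 2 := fun r => by ring
  simp only [h, Finset.sum_add_distrib, Finset.sum_sub_distrib, ← Finset.mul_sum, h1, hu, qq]
  ring

lemma qq_diag_ge {n m : ℕ} (B : Fin m → Matrix (Fin n) (Fin n) ℝ) (u : Fin m → ℝ)
    (hu : ∑ r, u r ^ 2 = 1) (η : Fin n → ℝ) (hd : comb u B = Matrix.diagonal η) (i : Fin n) :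
    η i ^ 2 ≤ qq B i i := by
  have h := diag_defect B u hu η hd i
  have : 0 ≤ ∑ r, (B r i i - η i * u r) ^ 2 := Finset.sum_nonneg fun _ _ => sq_nonneg _
  linarith

lemma TT_le_diag {n m : ℕ} (B : Fin m → Matrix (Fin n) (Fin n) ℝ) (hs : ∀ r, (B r).IsSymm)
    (u : Fin m → ℝ) (hu : ∑ r, u r ^ 2 = 1) (hpos : 0 < frobSq (comb u B))
    (hmax : ∀ v : Fin m → ℝ, frobSq (comb v B) ≤ (∑ r, v r ^ 2) * frobSq (comb u B))
    (η : Fin n → ℝ) (hd : comb u B = Matrix.diagonal η) :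
    TT (comb u B) B ≤ frobSq (comb u B) * SS B := by
  have ha : frobSq (comb u B) = ∑ i, η i ^ 2 := by rw [hd, frobSq_diagonal]
  have h := diag_bound B η (frobSq (comb u B)) ha hpos (frobSq (comb u B) / 2) (by linarith)
    (fun i j hij => qq_offdiag_le B hs _ hpos.le hmax i j hij)
  rw [← hd] at h
  have h2 : ∑ i, η i ^ 2 ≤ ∑ i, qq B i i := Finset.sum_le_sum fun i _ => qq_diag_ge B u hu η hd i
  rw [← ha] at h2
  unfold TT SS
  nlinarith

lemma TT_le {n m : ℕ} (B : Fin m → Matrix (Fin n) (Fin n) ℝ) (hs : ∀ r, (B r).IsSymm)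
    (u : Fin m → ℝ) (hu : ∑ r, u r ^ 2 = 1) (hpos : 0 < frobSq (comb u B))
    (hmax : ∀ v : Fin m → ℝ, frobSq (comb v B) ≤ (∑ r, v r ^ 2) * frobSq (comb u B)) :
    TT (comb u B) B ≤ frobSq (comb u B) * SS B := by
  obtain ⟨Q, η, hQ, -, hη⟩ := exists_diag (comb u B) (comb_symm u B hs)
  have hd : comb u (cj Q B) = Matrix.diagonal η := by
    rw [← hη]; exact comb_conj Q u B
  have := TT_le_diag (cj Q B) (cj_symm Q B hs) u hu (by rwa [frobSq_comb_cj Q hQ])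
    (fun v => by rw [frobSq_comb_cj Q hQ, frobSq_comb_cj Q hQ]; exact hmax v) η hd
  rwa [TT_cj Q hQ, SS_cj Q hQ, frobSq_comb_cj Q hQ] at this

lemma FF_smul {n m : ℕ} (c : ℝ) (B : Fin m → Matrix (Fin n) (Fin n) ℝ) :
    FF (fun r => c • B r) = c ^ 4 * FF B := by
  simp only [FF, mcomm_smul_smul, frobSq_smul, Finset.mul_sum]
  refine Finset.sum_congr rfl fun r _ => Finset.sum_congr rfl fun s _ => by ring

lemma SS_smul {n m : ℕ} (c : ℝ) (B : Fin m → Matrix (Fin n) (Fin n) ℝ) :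
    SS (fun r => c • B r) = c ^ 2 * SS B := by
  simp only [SS, frobSq_smul, Finset.mul_sum]

lemma SS_nonneg {n m : ℕ} (B : Fin m → Matrix (Fin n) (Fin n) ℝ) : 0 ≤ SS B :=
  Finset.sum_nonneg fun _ _ => frobSq_nonneg _

lemma SS_eq_zero {n m : ℕ} {B : Fin m → Matrix (Fin n) (Fin n) ℝ} (h : SS B = 0) : B = 0 := by
  funext r
  exact frobSq_eq_zero ((Finset.sum_eq_zero_iff_of_nonneg
    (fun r _ => frobSq_nonneg (B r))).1 h r (Finset.mem_univ r))

/-- Existence of an extremal family. -/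
lemma exists_extremal {n m : ℕ} (Y : Fin m → Matrix (Fin n) (Fin n) ℝ) (hY : ∀ r, (Y r).IsSymm)
    (hYpos : 0 < SS Y) :
    ∃ X : Fin m → Matrix (Fin n) (Fin n) ℝ, (∀ r, (X r).IsSymm) ∧ SS X = 1 ∧
      ∀ Z : Fin m → Matrix (Fin n) (Fin n) ℝ, (∀ r, (Z r).IsSymm) → FF Z ≤ FF X * SS Z ^ 2 := by
  let toM : (Fin m → Fin n → Fin n → ℝ) → Fin m → Matrix (Fin n) (Fin n) ℝ :=
    fun x r => Matrix.of (x r)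
  let K : Set (Fin m → Fin n → Fin n → ℝ) :=
    {x | (∀ r i j, x r i j = x r j i) ∧ ∑ r, ∑ i, ∑ j, x r i j ^ 2 = 1}
  have hKc : IsCompact K := by
    apply Metric.isCompact_of_isClosed_isBounded
    · have c1 : IsClosed {x : Fin m → Fin n → Fin n → ℝ | ∀ r i j, x r i j = x r j i} := by
        have he : {x : Fin m → Fin n → Fin n → ℝ | ∀ r i j, x r i j = x r j i} =
            ⋂ r, ⋂ i, ⋂ j, {x | x r i j = x r j i} := by
          ext x; simp
        rw [he]
        refine isClosed_iInter fun r => isClosed_iInter fun i => isClosed_iInter fun j => ?_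
        exact isClosed_eq (by fun_prop) (by fun_prop)
      have c2 : IsClosed {x : Fin m → Fin n → Fin n → ℝ | ∑ r, ∑ i, ∑ j, x r i j ^ 2 = 1} :=
        isClosed_eq (by fun_prop) continuous_const
      exact c1.inter c2
    · refine (Metric.isBounded_closedBall (x := (0 : Fin m → Fin n → Fin n → ℝ)) (r := 1)).subset ?_
      rintro x ⟨-, hx⟩
      rw [mem_closedBall_zero_iff]
      simp only [pi_norm_le_iff_of_nonneg zero_le_one]
      intro r i j
      have h1 : ∑ p : Fin m × Fin n × Fin n, (x p.1 p.2.1 p.2.2) ^ 2 = 1 := by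
        rw [← hx]
        simp only [Fintype.sum_prod_type]
      exact sq_le_of_sum (fun p : Fin m × Fin n × Fin n => x p.1 p.2.1 p.2.2) h1 (r, i, j)
  have hcont : Continuous fun x => FF (toM x) := by
    simp only [FF, frobSq, mcomm, Matrix.sub_apply, Matrix.mul_apply, toM, Matrix.of_apply]
    fun_prop
  have hnorm : ∀ Z : Fin m → Matrix (Fin n) (Fin n) ℝ, 0 < SS Z →
      SS (fun r => (Real.sqrt (SS Z))⁻¹ • Z r) = 1 := by
    intro Z hZ
    rw [SS_smul, inv_pow, Real.sq_sqrt hZ.le, inv_mul_cancel₀ hZ.ne']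
  have hmem : ∀ Z : Fin m → Matrix (Fin n) (Fin n) ℝ, (∀ r, (Z r).IsSymm) → 0 < SS Z →
      (fun r i j => ((Real.sqrt (SS Z))⁻¹ • Z r) i j) ∈ K := by
    intro Z hZ hpos
    refine ⟨fun r i j => ?_, hnorm Z hpos⟩
    simp only [Matrix.smul_apply, (hZ r).apply]
  obtain ⟨x, hx, hmax⟩ := hKc.exists_isMaxOn ⟨_, hmem Y hY hYpos⟩ hcont.continuousOn
  refine ⟨toM x, fun r => ?_, hx.2, ?_⟩
  · ext i j
    exact hx.1 r j i
  · intro Z hZ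
    rcases (SS_nonneg Z).eq_or_lt with h0 | h0
    · have := SS_eq_zero h0.symm
      subst this
      rw [← h0]
      simp [FF, mcomm, frobSq]
    · have h1 : FF (fun r => (Real.sqrt (SS Z))⁻¹ • Z r) ≤ FF (toM x) := hmax (hmem Z hZ h0)
      have h2 : (Real.sqrt (SS Z))⁻¹ ^ 4 = (SS Z ^ 2)⁻¹ := by
        rw [inv_pow, show (4:ℕ) = 2 * 2 from rfl, pow_mul, Real.sq_sqrt h0.le]
      rw [FF_smul, h2, inv_mul_le_iff₀ (by positivity)] at h1
      linarith

/-- The DDVV inequality. -/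
lemma ddvv_ineq {n m : ℕ} (Z : Fin m → Matrix (Fin n) (Fin n) ℝ) (hZ : ∀ r, (Z r).IsSymm) :
    FF Z ≤ 1 * SS Z ^ 2 := by
  rcases (SS_nonneg Z).eq_or_lt with h0 | h0
  · have := SS_eq_zero h0.symm
    subst this
    rw [← h0]
    simp [FF, mcomm, frobSq]
  · obtain ⟨X, hX, hX1, hext⟩ := exists_extremal Z hZ h0
    obtain ⟨u, hu, hpos, hmax⟩ := exists_max_dir X (by rw [hX1]; exact one_pos)
    have h1 := first_order X hX (FF X) hext (by rw [hX1]; ring) u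
    have h2 := TT_le X hX u hu hpos hmax
    rw [hX1] at h1 h2
    have h3 : FF X ≤ 1 := by
      by_contra hc
      push Not at hc
      nlinarith
    exact (hext Z hZ).trans (mul_le_mul_of_nonneg_right h3 (sq_nonneg _))

/-- The off-diagonal normal form at positions i, j. -/
def G1 {n : ℕ} (i j : Fin n) (μ : ℝ) : Matrix (Fin n) (Fin n) ℝ :=
  Matrix.of fun k l => if (k = i ∧ l = j) ∨ (k = j ∧ l = i) then μ else 0

/-- The diagonal normal form at positions i, j. -/
def G2 {n : ℕ} (i j : Fin n) (μ : ℝ) : Matrix (Fin n) (Fin n) ℝ :=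
  Matrix.of fun k l => if k = i ∧ l = i then μ else if k = j ∧ l = j then -μ else 0

lemma G1_mul_apply {n : ℕ} (i j : Fin n) (hij : i ≠ j) (c : ℝ) (X : Matrix (Fin n) (Fin n) ℝ)
    (k l : Fin n) :
    (G1 i j c * X) k l = (if k = i then c * X j l else 0) + (if k = j then c * X i l else 0) := by
  rw [Matrix.mul_apply]
  have : ∀ p, G1 i j c k p * X p l =
      (if p = j then (if k = i then c * X j l else 0) else 0) +
      (if p = i then (if k = j then c * X i l else 0) else 0) := by
    intro p
    simp only [G1, Matrix.of_apply]
    by_cases h1 : k = i <;> by_cases h2 : k = j <;> by_cases h3 : p = i <;> by_cases h4 : p = j <;>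
      simp_all
  simp only [this, Finset.sum_add_distrib, Finset.sum_ite_eq', Finset.mem_univ, if_true]

lemma mul_G1_apply {n : ℕ} (i j : Fin n) (hij : i ≠ j) (c : ℝ) (X : Matrix (Fin n) (Fin n) ℝ)
    (k l : Fin n) :
    (X * G1 i j c) k l = (if l = i then c * X k j else 0) + (if l = j then c * X k i else 0) := by
  rw [Matrix.mul_apply]
  have : ∀ p, X k p * G1 i j c p l =
      (if p = j then (if l = i then c * X k j else 0) else 0) +
      (if p = i then (if l = j then c * X k i else 0) else 0) := by
    intro p
    simp only [G1, Matrix.of_apply]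
    by_cases h1 : l = i <;> by_cases h2 : l = j <;> by_cases h3 : p = i <;> by_cases h4 : p = j <;>
      simp_all [mul_comm]
  simp only [this, Finset.sum_add_distrib, Finset.sum_ite_eq', Finset.mem_univ, if_true]

lemma frobSq_mcomm_G1 {n : ℕ} (i j : Fin n) (hij : i ≠ j) (c : ℝ) (X : Matrix (Fin n) (Fin n) ℝ)
    (hX : X.IsSymm) :
    frobSq (mcomm (G1 i j c) X) =
      c ^ 2 * (2 * ∑ l, (X i l ^ 2 + X j l ^ 2) - 4 * (X i i * X j j) - 4 * X i j ^ 2) := by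
  have hpt : ∀ k l, (mcomm (G1 i j c) X k l) ^ 2 =
      ((if k = i then c ^ 2 * X j l ^ 2 else 0) + (if k = j then c ^ 2 * X i l ^ 2 else 0)) +
      ((if l = i then c ^ 2 * X j k ^ 2 else 0) + (if l = j then c ^ 2 * X i k ^ 2 else 0)) -
      (((if k = i then (if l = i then 2 * c ^ 2 * X i j ^ 2 else 0) else 0) +
       (if k = i then (if l = j then 2 * c ^ 2 * (X i i * X j j) else 0) else 0)) +
      ((if k = j then (if l = i then 2 * c ^ 2 * (X i i * X j j) else 0) else 0) +
       (if k = j then (if l = j then 2 * c ^ 2 * X i j ^ 2 else 0) else 0))) := by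
    intro k l
    rw [mcomm, Matrix.sub_apply, G1_mul_apply i j hij, mul_G1_apply i j hij]
    have hji : j ≠ i := hij.symm
    have hs : ∀ p q, X p q = X q p := fun p q => (hX.apply q p)
    by_cases h1 : k = i
    · subst h1
      by_cases h3 : l = k
      · subst h3; simp [hij, hs j l]; try ring
      · by_cases h4 : l = j
        · subst h4; simp [hij, hji, hs l k]; try ring
        · simp [hij, h3, h4]; try ring
    · by_cases h2 : k = j
      · subst h2
        by_cases h3 : l = i
        · subst h3; simp [hij, hji, hs l k]; try ring
        · by_cases h4 : l = k
          · subst h4; simp [hij, hji, hs l i]; try ring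
          · simp [hji, h3, h4]; try ring
      · by_cases h3 : l = i
        · subst h3; simp [hij, h1, h2, hs k j]; try ring
        · by_cases h4 : l = j
          · subst h4; simp [hji, h1, h2, hs k i]; try ring
          · simp [h1, h2, h3, h4]
  simp only [frobSq, hpt, Finset.sum_sub_distrib, Finset.sum_add_distrib, Finset.sum_ite_eq',
    Finset.mem_univ, if_true]
  have e1 : ∀ f : Fin n → ℝ, ∀ p : Fin n,
      ∑ x, ∑ y, (if x = p then f y else 0) = ∑ y, f y := by
    intro f p
    rw [Finset.sum_comm]; simp
  simp only [e1, ← Finset.mul_sum, Finset.sum_ite_eq', Finset.mem_univ, if_true]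
  ring

lemma frobSq_sub_G1 {n : ℕ} (C : Matrix (Fin n) (Fin n) ℝ) (i j : Fin n) (hij : i ≠ j)
    (c : ℝ) (h1 : C i j = c) (h2 : C j i = c) :
    frobSq (C - G1 i j c) = frobSq C - 2 * c ^ 2 := by
  have hpt : ∀ k l, ((C - G1 i j c) k l) ^ 2 = C k l ^ 2 -
    ((if k = i then (if l = j then c ^ 2 else 0) else 0) +
      (if k = j then (if l = i then c ^ 2 else 0) else 0)) := by
    intro k l
    simp only [Matrix.sub_apply, G1, Matrix.of_apply]
    by_cases h3 : k = i
    · subst h3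
      by_cases h4 : l = j
      · subst h4; simp [h1, hij]
      · simp [h4, hij]
    · by_cases h5 : k = j
      · subst h5
        by_cases h4 : l = i
        · subst h4; simp [h2, hij.symm]
        · simp [h4, hij.symm]
      · simp [h3, h5]
  simp only [frobSq, hpt, Finset.sum_sub_distrib, Finset.sum_add_distrib]
  have e2 : ∀ z : ℝ, ∀ p q : Fin n,
      ∑ x, ∑ y, (if x = p then (if y = q then z else 0) else 0) = z := by
    intro z p q
    rw [Finset.sum_comm]; simp
  simp only [e2]
  ring

lemma entry_zero_of_frobSq {n : ℕ} (C : Matrix (Fin n) (Fin n) ℝ) (i j : Fin n) (hij : i ≠ j)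
    (c : ℝ) (h1 : C i j = c) (h2 : C j i = c) (hle : frobSq C ≤ 2 * c ^ 2) : C = G1 i j c := by
  have hz := frobSq_sub_G1 C i j hij c h1 h2
  have : frobSq (C - G1 i j c) = 0 := le_antisymm (by linarith) (frobSq_nonneg _)
  exact sub_eq_zero.1 (frobSq_eq_zero this)

lemma structure_diag {n m : ℕ} (hn : 2 ≤ n) (B : Fin m → Matrix (Fin n) (Fin n) ℝ)
    (hs : ∀ r, (B r).IsSymm)
    (u : Fin m → ℝ) (hu : ∑ r, u r ^ 2 = 1) (hpos : 0 < frobSq (comb u B))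
    (hmax : ∀ v : Fin m → ℝ, frobSq (comb v B) ≤ (∑ r, v r ^ 2) * frobSq (comb u B))
    (hfo : ∀ v : Fin m → ℝ, SS B * frobSq (comb v B) ≤ TT (comb v B) B)
    (η : Fin n → ℝ) (hd : comb u B = Matrix.diagonal η) :
    ∃ i j : Fin n, i ≠ j ∧ ∃ μ : ℝ, μ ≠ 0 ∧ ∃ w : Fin m → ℝ, ∑ r, w r ^ 2 = 1 ∧
      ∑ r, u r * w r = 0 ∧ ∀ r, B r = u r • G2 i j μ + w r • G1 i j μ := by
  set a := frobSq (comb u B) with hadef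
  have ha : a = ∑ i, η i ^ 2 := by rw [hadef, hd, frobSq_diagonal]
  have hqd := qq_diag_ge B u hu η hd
  have hoff := qq_offdiag_le B hs a hpos.le hmax
  -- maximal off-diagonal pair
  obtain ⟨⟨i, j⟩, hijm, hijmax⟩ := Finset.exists_max_image
    (Finset.univ.filter fun p : Fin n × Fin n => p.1 ≠ p.2) (fun p => qq B p.1 p.2)
    ⟨(⟨0, by omega⟩, ⟨1, by omega⟩), by simp⟩
  have hij : i ≠ j := by simpa using hijm
  have hM : ∀ k l, k ≠ l → qq B k l ≤ qq B i j := fun k l hkl => hijmax (k, l) (by simpa using hkl)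
  have hb := diag_bound B η a ha hpos (qq B i j) (qq_nonneg _ _ _) hM
  have hfu := hfo u
  rw [hd] at hfu
  rw [← hd, ← hadef, hd] at hfu
  have hsumd : a ≤ ∑ k, qq B k k := by rw [ha]; exact Finset.sum_le_sum fun k _ => hqd k
  have h1 : a * ∑ k, qq B k k ≤ a * (2 * qq B i j) := by
    unfold SS TT at hfu; linarith
  have h2 : ∑ k, qq B k k ≤ 2 * qq B i j := le_of_mul_le_mul_left h1 hpos
  have hqij : qq B i j = a / 2 := le_antisymm (hoff i j hij) (by linarith)
  have hqk : ∀ k, qq B k k = η k ^ 2 := by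
    have : ∑ k, η k ^ 2 = ∑ k, qq B k k := by
      apply le_antisymm
      · rw [← ha]; exact hsumd
      · rw [← ha]; linarith
    intro k
    exact ((Finset.sum_eq_sum_iff_of_le fun k _ => hqd k).1 this k (Finset.mem_univ k)).symm
  have hBkk : ∀ r k, B r k k = η k * u r := by
    intro r k
    have h := diag_defect B u hu η hd k
    rw [hqk, sub_self] at h
    have := (Finset.sum_eq_zero_iff_of_nonneg (fun r _ => sq_nonneg (B r k k - η k * u r))).1 h r
      (Finset.mem_univ r)
    have := pow_eq_zero_iff (two_ne_zero) |>.1 this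
    linarith
  -- the direction of the (i,j) entries
  have hC : comb (fun r => B r i j) B = G1 i j (a / 2) := by
    have e1 : comb (fun r => B r i j) B i j = a / 2 := by
      rw [comb_apply, ← hqij, qq]; exact Finset.sum_congr rfl fun r _ => by ring
    apply entry_zero_of_frobSq _ i j hij _ e1
    · rw [(comb_symm _ B hs).apply, e1]
    · refine (hmax _).trans ?_
      change qq B i j * a ≤ _
      rw [hqij]; apply le_of_eq; ring
  have hfw := hfo (fun r => B r i j)
  have hfC : frobSq (G1 i j (a / 2)) = a ^ 2 / 2 := by
    have e := frobSq_sub_G1 (G1 i j (a / 2)) i j hij (a / 2) (by simp [G1]) (by simp [G1])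
    have e0 : frobSq (0 : Matrix (Fin n) (Fin n) ℝ) = 0 := by simp [frobSq]
    rw [sub_self, e0] at e
    linarith
  rw [hC, hfC] at hfw
  have hTT : TT (G1 i j (a / 2)) B = (a / 2) ^ 2 *
      (2 * ∑ l, (qq B i l + qq B j l) - 4 * (η i * η j) - 4 * (a / 2)) := by
    unfold TT
    simp only [fun r => frobSq_mcomm_G1 i j hij (a / 2) (B r) (hs r)]
    rw [← Finset.mul_sum, ← hqij]
    congr 1
    simp only [Finset.sum_sub_distrib, ← Finset.mul_sum]
    have e1 : ∑ r, ∑ l, (B r i l ^ 2 + B r j l ^ 2) = ∑ l, (qq B i l + qq B j l) := by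
      rw [Finset.sum_comm]
      simp only [qq, Finset.sum_add_distrib]
    have e2 : ∑ r, B r i i * B r j j = η i * η j := by
      have : ∀ r, B r i i * B r j j = (η i * η j) * u r ^ 2 := fun r => by
        rw [hBkk, hBkk]; ring
      simp only [this, ← Finset.mul_sum, hu, mul_one]
    rw [e1, e2]
    rfl
  rw [hTT] at hfw
  have hS : SS B ≤ ∑ l, (qq B i l + qq B j l) - 2 * (η i * η j) - a := by
    have : (a ^ 2 / 2) * SS B ≤ (a ^ 2 / 2) *
        (∑ l, (qq B i l + qq B j l) - 2 * (η i * η j) - a) := by nlinarith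
    exact le_of_mul_le_mul_left this (by positivity)
  have hsplit : ∀ f : Fin n → ℝ, ∑ k, f k = f i + f j +
      ∑ k ∈ Finset.univ.filter (fun k => k ≠ i ∧ k ≠ j), f k := by
    intro f
    have hpair : Finset.univ.filter (fun k : Fin n => ¬ (k ≠ i ∧ k ≠ j)) = {i, j} := by
      ext k; simp; tauto
    rw [← Finset.sum_filter_add_sum_filter_not Finset.univ (fun k => k ≠ i ∧ k ≠ j), hpair,
      Finset.sum_pair hij]
    ring
  have hSe : SS B = ∑ l, (qq B i l + qq B j l) +
      ∑ k ∈ Finset.univ.filter (fun k => k ≠ i ∧ k ≠ j), ∑ l, qq B k l := by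
    unfold SS
    rw [sum_frobSq_eq, hsplit, Finset.sum_add_distrib]
  have hae := hsplit (fun k => η k ^ 2)
  rw [← ha] at hae
  have hR1 : 0 ≤ ∑ k ∈ Finset.univ.filter (fun k => k ≠ i ∧ k ≠ j), ∑ l, qq B k l :=
    Finset.sum_nonneg fun _ _ => Finset.sum_nonneg fun _ _ => qq_nonneg _ _ _
  have hR2 : 0 ≤ ∑ k ∈ Finset.univ.filter (fun k => k ≠ i ∧ k ≠ j), η k ^ 2 :=
    Finset.sum_nonneg fun _ _ => sq_nonneg _
  have hz0 : (η i + η j) ^ 2 = 0 := by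
    apply le_antisymm _ (sq_nonneg _)
    nlinarith
  have hz1 : ∑ k ∈ Finset.univ.filter (fun k => k ≠ i ∧ k ≠ j), ∑ l, qq B k l = 0 := by
    apply le_antisymm _ hR1
    nlinarith [sq_nonneg (η i + η j)]
  have hz2 : ∑ k ∈ Finset.univ.filter (fun k => k ≠ i ∧ k ≠ j), η k ^ 2 = 0 := by
    apply le_antisymm _ hR2
    nlinarith [sq_nonneg (η i + η j)]
  have hηj : η j = - η i := by
    have := pow_eq_zero_iff (two_ne_zero) |>.1 hz0
    linarith
  have ha2 : a = 2 * η i ^ 2 := by rw [hae, hz2, hηj]; ring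
  have hBz : ∀ r k l, k ≠ i → k ≠ j → B r k l = 0 := by
    intro r k l hki hkj
    have e1 := (Finset.sum_eq_zero_iff_of_nonneg (fun k _ => Finset.sum_nonneg
      fun l _ => qq_nonneg B k l)).1 hz1 k (by simp [hki, hkj])
    have e2 := (Finset.sum_eq_zero_iff_of_nonneg (fun l _ => qq_nonneg B k l)).1 e1 l
      (Finset.mem_univ l)
    have e3 := (Finset.sum_eq_zero_iff_of_nonneg (fun r _ => sq_nonneg (B r k l))).1 e2 r
      (Finset.mem_univ r)
    simpa using e3
  have hμ : η i ≠ 0 := by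
    intro h; rw [h] at ha2; simp at ha2; linarith
  refine ⟨i, j, hij, η i, hμ, fun r => (η i)⁻¹ * B r i j, ?_, ?_, ?_⟩
  · simp only [mul_pow, ← Finset.mul_sum]
    change _ * qq B i j = 1
    rw [hqij, ha2]; field_simp
  · have e : comb u B i j = 0 := by rw [hd]; simp [hij]
    rw [comb_apply] at e
    have : ∀ r, u r * ((η i)⁻¹ * B r i j) = (η i)⁻¹ * (u r * B r i j) := fun r => by ring
    simp only [this, ← Finset.mul_sum, e, mul_zero]
  · intro r
    have hsym : ∀ k l, B r k l = B r l k := fun k l => (hs r).apply l k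
    have hji := hij.symm
    ext k l
    simp only [Matrix.add_apply, Matrix.smul_apply, G1, G2, Matrix.of_apply, smul_eq_mul]
    by_cases h1 : k = i
    · subst h1
      by_cases h3 : l = k
      · subst h3; simp [hij, hBkk, mul_comm]
      · by_cases h4 : l = j
        · subst h4; simp [hij, hji]; field_simp
        · rw [hsym, hBz r l k h3 h4]; simp [hij, h3, h4]
    · by_cases h2 : k = j
      · subst h2
        by_cases h3 : l = i
        · subst h3; simp [hij, hji]; rw [hsym k l]; field_simp
        · by_cases h4 : l = k
          · subst h4; simp [hji, hBkk, hηj, mul_comm]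
          · rw [hsym, hBz r l k h3 h4]; simp [h3, h4, hji]
      · rw [hBz r k l h1 h2]; simp [h1, h2]

/-- The permutation part of the change of basis. -/
lemma exists_perm {n : ℕ} (hn : 2 ≤ n) (i j : Fin n) (hij : i ≠ j) :
    ∃ σ : Equiv.Perm (Fin n), (∀ k, (σ.symm k).1 = 0 ↔ k = i) ∧ (∀ k, (σ.symm k).1 = 1 ↔ k = j) := by
  let z : Fin n := ⟨0, by omega⟩
  let o : Fin n := ⟨1, by omega⟩
  have hzo : z ≠ o := by simp [z, o]
  let τ : Equiv.Perm (Fin n) := Equiv.swap z i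
  let σ : Equiv.Perm (Fin n) := τ.trans (Equiv.swap (τ o) j)
  have hτz : τ z = i := Equiv.swap_apply_left _ _
  have hτo : τ o ≠ i := fun h => hzo (τ.injective (hτz.trans h.symm))
  have hσz : σ z = i := by
    simp only [σ, Equiv.trans_apply, hτz]
    exact Equiv.swap_apply_of_ne_of_ne hτo.symm hij
  have hσo : σ o = j := by
    simp only [σ, Equiv.trans_apply]
    exact Equiv.swap_apply_left _ _
  refine ⟨σ, fun k => ?_, fun k => ?_⟩
  · rw [← hσz, ← Equiv.symm_apply_eq, Fin.ext_iff]
  · rw [← hσo, ← Equiv.symm_apply_eq, Fin.ext_iff]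

lemma perm_conj {n : ℕ} (Q H : Matrix (Fin n) (Fin n) ℝ) (σ : Equiv.Perm (Fin n)) :
    Q.submatrix id σ * H * (Q.submatrix id σ)ᵀ = Q * H.submatrix σ.symm σ.symm * Qᵀ := by
  have h1 : Q.submatrix id σ * H = (Q * H.submatrix σ.symm σ.symm).submatrix id σ := by
    have : H = (H.submatrix σ.symm σ.symm).submatrix σ σ := by
      ext k l; simp
    conv_lhs => rw [this]
    rw [Matrix.submatrix_mul_equiv]
  rw [h1, Matrix.transpose_submatrix, Matrix.submatrix_mul_equiv]
  simp

lemma exists_rotation {m : ℕ} (u w : Fin m → ℝ) (hu : ∑ r, u r ^ 2 = 1) (hw : ∑ r, w r ^ 2 = 1)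
    (huw : ∑ r, u r * w r = 0) (r₁ r₂ : Fin m) (h12 : r₁ ≠ r₂) :
    ∃ R : Matrix (Fin m) (Fin m) ℝ, R ∈ Matrix.orthogonalGroup (Fin m) ℝ ∧
      (∀ s, R s r₁ = w s) ∧ (∀ s, R s r₂ = u s) := by
  let v : Fin m → EuclideanSpace ℝ (Fin m) :=
    fun r => if r = r₁ then WithLp.toLp 2 w else WithLp.toLp 2 u
  have hin : ∀ x y : EuclideanSpace ℝ (Fin m), inner ℝ x y = ∑ s, x s * y s := by
    intro x y
    rw [PiLp.inner_apply]
    exact Finset.sum_congr rfl fun s _ => by simp [mul_comm]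
  have hv : Orthonormal ℝ (({r₁, r₂} : Set (Fin m)).domRestrict v) := by
    rw [orthonormal_iff_ite]
    rintro ⟨p, hp⟩ ⟨q, hq⟩
    rw [hin]
    simp only [Set.domRestrict_apply, Subtype.mk.injEq]
    rcases hp with rfl | rfl <;> rcases hq with rfl | rfl
    · simpa [v, ← sq] using hw
    · simpa [v, h12, h12.symm, mul_comm] using huw
    · simpa [v, h12, h12.symm] using huw
    · simpa [v, h12.symm, ← sq] using hu
  obtain ⟨b, hb⟩ := hv.exists_orthonormalBasis_extension_of_card_eq (by simp)
  refine ⟨Matrix.of fun s r => b r s, ?_, ?_, ?_⟩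
  · rw [Matrix.mem_orthogonalGroup_iff']
    ext p q
    have := orthonormal_iff_ite.1 b.orthonormal p q
    rw [hin] at this
    simpa [Matrix.mul_apply, Matrix.one_apply, Matrix.star_eq_conjTranspose] using this
  · intro s
    simp [hb r₁ (by simp), v]
  · intro s
    simp [hb r₂ (by simp), v, h12.symm]

/-- The equality case of the DDVV inequality: if equality holds for a family of nonzero
symmetric matrices, then after a rotation of the family all matrices vanish except two,
which have the normal forms `P H₁ Pᵗ` and `P H₂ Pᵗ`. -/
theorem ddvv_equality_case (n m : ℕ) (hn : 2 ≤ n) (hm : 2 ≤ m)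
    (B : Fin m → Matrix (Fin n) (Fin n) ℝ) (hsymm : ∀ r, (B r).IsSymm)
    (hne : B ≠ 0)
    (heq : ∑ r, ∑ s, frobSq (mcomm (B r) (B s)) = (∑ r, frobSq (B r)) ^ 2) :
    ∃ R : Matrix (Fin m) (Fin m) ℝ, R ∈ Matrix.orthogonalGroup (Fin m) ℝ ∧
    ∃ P : Matrix (Fin n) (Fin n) ℝ, P ∈ Matrix.orthogonalGroup (Fin n) ℝ ∧
    ∃ μ : ℝ, μ ≠ 0 ∧
    ∃ r₁ r₂ : Fin m, r₁ ≠ r₂ ∧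
      (∀ r, r ≠ r₁ → r ≠ r₂ → (∑ s, R s r • B s) = 0) ∧
      (∑ s, R s r₁ • B s) = P * H1 n μ * Pᵀ ∧
      (∑ s, R s r₂ • B s) = P * H2 n μ * Pᵀ := by
  have hSpos : 0 < SS B := by
    rcases (SS_nonneg B).eq_or_lt with h | h
    · exact absurd (SS_eq_zero h.symm) hne
    · exact h
  have hF : FF B = 1 * SS B ^ 2 := by rw [one_mul]; exact heq
  obtain ⟨u, hu, hpos, hmax⟩ := exists_max_dir B hSpos
  obtain ⟨Q, η, hQ, hQ', hη⟩ := exists_diag (comb u B) (comb_symm u B hsymm)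
  have hd : comb u (cj Q B) = Matrix.diagonal η := by
    rw [← hη]; exact comb_conj Q u B
  obtain ⟨i, j, hij, μ, hμ, w, hw, huw, hB⟩ := structure_diag hn (cj Q B) (cj_symm Q B hsymm) u hu
    (by rwa [frobSq_comb_cj Q hQ])
    (fun v => by rw [frobSq_comb_cj Q hQ, frobSq_comb_cj Q hQ]; exact hmax v)
    (fun v => by
      rw [frobSq_comb_cj Q hQ, SS_cj Q hQ, TT_cj Q hQ]
      have := first_order B hsymm 1 ddvv_ineq hF v
      rwa [one_mul] at this) η hd
  have hBr : ∀ r, B r = Q * (u r • G2 i j μ + w r • G1 i j μ) * Qᵀ := by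
    intro r
    rw [← hB r, cj]
    have : Q * (Qᵀ * B r * Q) * Qᵀ = (Q * Qᵀ) * B r * (Q * Qᵀ) := by simp only [Matrix.mul_assoc]
    rw [this, hQ, Matrix.one_mul, Matrix.mul_one]
  let r₁ : Fin m := ⟨0, by omega⟩
  let r₂ : Fin m := ⟨1, by omega⟩
  have h12 : r₁ ≠ r₂ := by simp [r₁, r₂]
  obtain ⟨R, hR, hR1, hR2⟩ := exists_rotation u w hu hw huw r₁ r₂ h12
  obtain ⟨σ, hσ0, hσ1⟩ := exists_perm hn i j hij
  have hsum : ∀ r, ∑ s, R s r • B s =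
      Q * ((∑ s, R s r * u s) • G2 i j μ + (∑ s, R s r * w s) • G1 i j μ) * Qᵀ := by
    intro r
    have : ∀ s, R s r • B s = Q * ((R s r * u s) • G2 i j μ + (R s r * w s) • G1 i j μ) * Qᵀ := by
      intro s
      rw [hBr s, ← smul_smul, ← smul_smul, ← smul_add, Matrix.mul_smul, Matrix.smul_mul]
    simp only [this]
    rw [← Finset.sum_mul, ← Finset.mul_sum, Finset.sum_add_distrib, ← Finset.sum_smul,
      ← Finset.sum_smul]
  have horth : ∀ p q, ∑ s, R s p * R s q = if p = q then 1 else 0 := by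
    intro p q
    have := congrFun (congrFun ((Matrix.mem_orthogonalGroup_iff' _ _).1 hR) p) q
    simpa [Matrix.mul_apply, Matrix.one_apply, Matrix.star_eq_conjTranspose] using this
  have hu' : ∀ r, ∑ s, R s r * u s = if r = r₂ then 1 else 0 := by
    intro r; simp only [← hR2]; exact horth r r₂
  have hw' : ∀ r, ∑ s, R s r * w s = if r = r₁ then 1 else 0 := by
    intro r; simp only [← hR1]; exact horth r r₁
  refine ⟨R, hR, Q.submatrix id σ, ?_, μ, hμ, r₁, r₂, h12, ?_, ?_, ?_⟩
  · rw [Matrix.mem_orthogonalGroup_iff]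
    have := perm_conj Q 1 σ
    rw [Matrix.mul_one, Matrix.submatrix_one_equiv, Matrix.mul_one, hQ] at this
    exact this
  · intro r h1 h2
    rw [hsum, hu', hw', if_neg h1, if_neg h2]
    simp
  · rw [hsum, hu', hw', if_neg h12, if_pos rfl, perm_conj]
    congr 2
    ext k l
    simp [G1, H1, hσ0, hσ1]
  · rw [hsum, hu', hw', if_neg h12.symm, if_pos rfl, perm_conj]
    congr 2
    ext k l
    simp [G2, H2, hσ0, hσ1]
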